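/- arXiv:2108.11440 — 3 statements merged into one kernel-verified Lean document; each statement's English description precedes it below -/
import Mathlib

section
/- If f : ℝⁿ → (-∞,+∞] is proper with dom f ∩ dom φ ≠ ∅ and f is bounded below by an affine function (i.e. f(x) ≥ ⟨u,x⟩ + η for some u ∈ ℝⁿ, η ∈ ℝ, and all x), then f is φ-prox-bounded with threshold λ_f = +∞, that is, for every λ > 0 the envelope env^φ_λ f is somewhere finite. In particular, every f ∈ Γ₀(ℝⁿ) with dom f ∩ dom φ ≠ ∅ has λ_f = +∞. -/
open scoped RealInnerProductSpace Pointwise Topology Classical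

noncomputable section

/-- Effective domain of an extended-real-valued function. -/
def edom {n : ℕ} (f : EuclideanSpace ℝ (Fin n) → EReal) : Set (EuclideanSpace ℝ (Fin n)) :=
  {x | f x ≠ ⊤}

/-- Proper: nowhere `⊥` and not identically `⊤`. -/
def ProperFn {n : ℕ} (f : EuclideanSpace ℝ (Fin n) → EReal) : Prop :=
  (∀ x, f x ≠ ⊥) ∧ ∃ x, f x ≠ ⊤

/-- Convexity for extended-real-valued functions. -/
def ConvexFn {n : ℕ} (f : EuclideanSpace ℝ (Fin n) → EReal) : Prop :=
  ∀ x y : EuclideanSpace ℝ (Fin n), ∀ a b : ℝ, 0 ≤ a → 0 ≤ b → a + b = 1 →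
    f (a • x + b • y) ≤ (a : EReal) * f x + (b : EReal) * f y

/-- `Γ₀`: proper, lower semicontinuous, convex. -/
def Gamma0 {n : ℕ} (f : EuclideanSpace ℝ (Fin n) → EReal) : Prop :=
  ProperFn f ∧ LowerSemicontinuous f ∧ ConvexFn f

/-- Fenchel conjugate. -/
def fconj {n : ℕ} (f : EuclideanSpace ℝ (Fin n) → EReal) (y : EuclideanSpace ℝ (Fin n)) :
    EReal :=
  ⨆ x, ((⟪y, x⟫ : ℝ) : EReal) - f x

/-- Convex subdifferential. -/
def subdiff {n : ℕ} (f : EuclideanSpace ℝ (Fin n) → EReal) (x : EuclideanSpace ℝ (Fin n)) :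
    Set (EuclideanSpace ℝ (Fin n)) :=
  {u | ∀ y, f x + ((⟪u, y - x⟫ : ℝ) : EReal) ≤ f y}

/-- 1-coercive (supercoercive): `f x / ‖x‖ → ∞` as `‖x‖ → ∞`. -/
def SuperCoercive {n : ℕ} (f : EuclideanSpace ℝ (Fin n) → EReal) : Prop :=
  ∀ c : ℝ, ∃ R : ℝ, ∀ x, R ≤ ‖x‖ → ((c * ‖x‖ : ℝ) : EReal) ≤ f x

/-- Legendre-type function `φ` with gradient map `gφ` on `U = int (dom φ)`:
proper, lsc, convex, `U ≠ ∅`, differentiable on `U`, essentially smooth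
(gradient blows up along sequences approaching the boundary), and
essentially strictly convex (strictly convex on `U`). -/
structure IsLegendre {n : ℕ} (φ : EuclideanSpace ℝ (Fin n) → EReal)
    (gφ : EuclideanSpace ℝ (Fin n) → EuclideanSpace ℝ (Fin n)) : Prop where
  proper : ProperFn φ
  lsc : LowerSemicontinuous φ
  convex : ConvexFn φ
  intNonempty : (interior (edom φ)).Nonempty
  grad : ∀ x ∈ interior (edom φ), HasGradientAt (fun y => (φ y).toReal) (gφ x) x
  essSmooth : ∀ (u : ℕ → EuclideanSpace ℝ (Fin n)) (x : EuclideanSpace ℝ (Fin n)),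
      (∀ k, u k ∈ interior (edom φ)) → x ∈ frontier (edom φ) →
      Filter.Tendsto u Filter.atTop (nhds x) →
      Filter.Tendsto (fun k => ‖gφ (u k)‖) Filter.atTop Filter.atTop
  essStrictConvex : ∀ x ∈ interior (edom φ), ∀ y ∈ interior (edom φ), x ≠ y →
      ∀ a b : ℝ, 0 < a → 0 < b → a + b = 1 →
      φ (a • x + b • y) < (a : EReal) * φ x + (b : EReal) * φ y

/-- Bregman distance `D_φ`. -/
def bregman {n : ℕ} (φ : EuclideanSpace ℝ (Fin n) → EReal)
    (gφ : EuclideanSpace ℝ (Fin n) → EuclideanSpace ℝ (Fin n))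
    (x y : EuclideanSpace ℝ (Fin n)) : EReal :=
  if y ∈ interior (edom φ) then φ x - φ y - ((⟪gφ y, x - y⟫ : ℝ) : EReal) else ⊤

/-- Left Bregman envelope `env^φ_λ f`. -/
def benv {n : ℕ} (φ : EuclideanSpace ℝ (Fin n) → EReal)
    (gφ : EuclideanSpace ℝ (Fin n) → EuclideanSpace ℝ (Fin n)) (lam : ℝ)
    (f : EuclideanSpace ℝ (Fin n) → EReal) (y : EuclideanSpace ℝ (Fin n)) : EReal :=
  ⨅ x, f x + ((1 / lam : ℝ) : EReal) * bregman φ gφ x y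

/-- Left Bregman proximal map `prox^φ_λ f` (set of minimizers). -/
def bprox {n : ℕ} (φ : EuclideanSpace ℝ (Fin n) → EReal)
    (gφ : EuclideanSpace ℝ (Fin n) → EuclideanSpace ℝ (Fin n)) (lam : ℝ)
    (f : EuclideanSpace ℝ (Fin n) → EReal) (y : EuclideanSpace ℝ (Fin n)) :
    Set (EuclideanSpace ℝ (Fin n)) :=
  {x | f x + ((1 / lam : ℝ) : EReal) * bregman φ gφ x y ≠ ⊤ ∧
    ∀ z, f x + ((1 / lam : ℝ) : EReal) * bregman φ gφ x y ≤
      f z + ((1 / lam : ℝ) : EReal) * bregman φ gφ z y}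

/-- φ-prox-boundedness threshold `λ_f`. -/
def proxThreshold {n : ℕ} (φ : EuclideanSpace ℝ (Fin n) → EReal)
    (gφ : EuclideanSpace ℝ (Fin n) → EuclideanSpace ℝ (Fin n))
    (f : EuclideanSpace ℝ (Fin n) → EReal) : EReal :=
  sSup ((fun lam : ℝ => (lam : EReal)) ''
    {lam : ℝ | 0 < lam ∧ ∃ x, benv φ gφ lam f x ≠ ⊥})

/-- λ-φ-proximal hull: pointwise supremum of all minorants `c - (1/λ) D_φ(·, w)`. -/
def phull {n : ℕ} (φ : EuclideanSpace ℝ (Fin n) → EReal)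
    (gφ : EuclideanSpace ℝ (Fin n) → EuclideanSpace ℝ (Fin n)) (lam : ℝ)
    (f : EuclideanSpace ℝ (Fin n) → EReal) (x : EuclideanSpace ℝ (Fin n)) : EReal :=
  ⨆ (c : ℝ) (w : EuclideanSpace ℝ (Fin n)) (_ : w ∈ interior (edom φ))
    (_ : ∀ z, (c : EReal) - ((1 / lam : ℝ) : EReal) * bregman φ gφ z w ≤ f z),
    ((c : EReal) - ((1 / lam : ℝ) : EReal) * bregman φ gφ x w)

/-- Combettes–Reyes anisotropic envelope `f □ ψ`. -/
def aenv {n : ℕ} (ψ f : EuclideanSpace ℝ (Fin n) → EReal) (x : EuclideanSpace ℝ (Fin n)) :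
    EReal :=
  ⨅ y, f y + ψ (x - y)

/-- Combettes–Reyes anisotropic proximal map `aprox^ψ f`. -/
def aprox {n : ℕ} (ψ f : EuclideanSpace ℝ (Fin n) → EReal) (x : EuclideanSpace ℝ (Fin n)) :
    Set (EuclideanSpace ℝ (Fin n)) :=
  {y | f y + ψ (x - y) ≠ ⊤ ∧ ∀ z, f y + ψ (x - y) ≤ f z + ψ (x - z)}

/-- Subtraction with the conventions `⊤ - ⊤ = ⊤` and `⊤ - r = ⊤`. -/
def esub (a b : EReal) : EReal := if a = ⊤ then ⊤ else a - b

/-- Convex hull of a function: the largest convex minorant. -/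
def convFn {n : ℕ} (f : EuclideanSpace ℝ (Fin n) → EReal) (x : EuclideanSpace ℝ (Fin n)) :
    EReal :=
  ⨆ (g : EuclideanSpace ℝ (Fin n) → EReal) (_ : ConvexFn g ∧ ∀ y, g y ≤ f y), g x

/-- Epi-multiplication `μ ⋆ g`. -/
def epiMul {n : ℕ} (μ : ℝ) (g : EuclideanSpace ℝ (Fin n) → EReal)
    (x : EuclideanSpace ℝ (Fin n)) : EReal :=
  if 0 < μ then (μ : EReal) * g ((1 / μ) • x) else (if x = 0 then 0 else ⊤)

/-- Infimal convolution. -/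
def infConv {n : ℕ} (g h : EuclideanSpace ℝ (Fin n) → EReal)
    (x : EuclideanSpace ℝ (Fin n)) : EReal :=
  ⨅ u, g u + h (x - u)

/-- The α-weighted Bregman proximal average with parameter λ. -/
def pavg {n : ℕ} (φ : EuclideanSpace ℝ (Fin n) → EReal) (lam α : ℝ)
    (f1 f2 : EuclideanSpace ℝ (Fin n) → EReal) (x : EuclideanSpace ℝ (Fin n)) : EReal :=
  esub
    (fconj (fun y =>
      (α : EReal) * fconj (fun z => f1 z + ((1 / lam : ℝ) : EReal) * φ z) y
        + ((1 - α : ℝ) : EReal) * fconj (fun z => f2 z + ((1 / lam : ℝ) : EReal) * φ z) y) x)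
    (((1 / lam : ℝ) : EReal) * φ x)

/-- Argmin set of an extended-real-valued function. -/
def argminSet {n : ℕ} (f : EuclideanSpace ℝ (Fin n) → EReal) :
    Set (EuclideanSpace ℝ (Fin n)) :=
  {x | f x ≠ ⊤ ∧ ∀ y, f x ≤ f y}

/-- A proper lower semicontinuous supercoercive function dominates `c * ‖x‖ + m` for every
slope `c` and some constant `m`. -/
theorem SuperCoercive.exists_norm_minorant {n : ℕ} {φ : EuclideanSpace ℝ (Fin n) → EReal}
    (hco : SuperCoercive φ) (hp : ProperFn φ) (hlsc : LowerSemicontinuous φ) {c : ℝ}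
    (hc : 0 ≤ c) : ∃ m : ℝ, ∀ x, ((c * ‖x‖ + m : ℝ) : EReal) ≤ φ x := by
  obtain ⟨R, hR⟩ := hco c
  obtain ⟨a, -, ha⟩ := (hlsc.lowerSemicontinuousOn (Metric.closedBall 0 |R|)).exists_isMinOn
    ⟨0, Metric.mem_closedBall_self (abs_nonneg R)⟩ (isCompact_closedBall _ _)
  obtain ⟨q, -, hq⟩ := EReal.lt_iff_exists_real_btwn.1 (bot_lt_iff_ne_bot.2 (hp.1 a))
  refine ⟨min 0 (q - c * |R|), fun x => ?_⟩
  rcases le_total R ‖x‖ with h | h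
  · refine le_trans (EReal.coe_le_coe_iff.2 ?_) (hR x h)
    linarith [min_le_left 0 (q - c * |R|)]
  · have hx : ‖x‖ ≤ |R| := h.trans (le_abs_self R)
    refine le_trans (EReal.coe_le_coe_iff.2 ?_)
      (hq.le.trans (ha (mem_closedBall_zero_iff.2 hx)))
    linarith [min_le_right 0 (q - c * |R|), mul_le_mul_of_nonneg_left hx hc]

/-- A function of `Γ₀` has a continuous affine minorant. -/
theorem Gamma0.exists_affine_minorant {n : ℕ} {g : EuclideanSpace ℝ (Fin n) → EReal}
    (hg : Gamma0 g) :
    ∃ (u : EuclideanSpace ℝ (Fin n)) (η : ℝ), ∀ x, ((⟪u, x⟫ + η : ℝ) : EReal) ≤ g x := by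
  obtain ⟨⟨hbot, x₀, hx₀⟩, hlsc, hconv⟩ := hg
  let epi : Set (EuclideanSpace ℝ (Fin n) × ℝ) := {p | g p.1 ≤ (p.2 : EReal)}
  have hclosed : IsClosed epi :=
    hlsc.isClosed_epigraph.preimage
      (continuous_fst.prodMk (continuous_coe_real_ereal.comp continuous_snd))
  have hepi : Convex ℝ epi := by
    intro p hp q hq a b ha hb hab
    refine (hconv p.1 q.1 a b ha hb hab).trans ?_
    have h₁ := mul_le_mul_of_nonneg_left (show g p.1 ≤ (p.2 : EReal) from hp)
      (EReal.coe_nonneg.2 ha)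
    have h₂ := mul_le_mul_of_nonneg_left (show g q.1 ≤ (q.2 : EReal) from hq)
      (EReal.coe_nonneg.2 hb)
    simpa using add_le_add h₁ h₂
  obtain ⟨r, hr⟩ : ∃ r : ℝ, g x₀ = r := ⟨_, (EReal.coe_toReal hx₀ (hbot x₀)).symm⟩
  have hnot : (x₀, r - 1) ∉ epi := by
    intro h
    have h' : g x₀ ≤ ((r - 1 : ℝ) : EReal) := h
    rw [hr, EReal.coe_le_coe_iff] at h'
    linarith
  obtain ⟨L, s, hs, hL⟩ := geometric_hahn_banach_point_closed hepi hclosed hnot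
  let l : StrongDual ℝ (EuclideanSpace ℝ (Fin n)) := L.comp (.inl ℝ _ ℝ)
  have hsplit (x : EuclideanSpace ℝ (Fin n)) (t : ℝ) : L (x, t) = l x + t * L (0, 1) := by
    have : (x, t) = (x, (0 : ℝ)) + t • ((0 : EuclideanSpace ℝ (Fin n)), (1 : ℝ)) := by simp
    rw [this, map_add, map_smul]
    rfl
  have hα : 0 < L (0, 1) := by
    have := hL (x₀, r) hr.le
    rw [hsplit] at this hs
    linarith
  refine ⟨-(L (0, 1))⁻¹ • (InnerProductSpace.toDual ℝ _).symm l, s / L (0, 1), fun x => ?_⟩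
  by_cases hx : g x = ⊤
  · simp [hx]
  obtain ⟨t, ht⟩ : ∃ t : ℝ, g x = t := ⟨_, (EReal.coe_toReal hx (hbot x)).symm⟩
  have := hL (x, t) ht.le
  rw [hsplit] at this
  rw [ht, EReal.coe_le_coe_iff, real_inner_smul_left, InnerProductSpace.toDual_symm_apply]
  have : -(L (0, 1))⁻¹ * l x + s / L (0, 1) = (s - l x) / L (0, 1) := by ring
  rw [this, div_le_iff₀ hα]
  linarith

/-- The left Bregman envelope of a function with an affine minorant is bounded below at each
point of `int (dom φ)`. -/
theorem benv_ne_bot_of_affine_minorant {n : ℕ} {φ f : EuclideanSpace ℝ (Fin n) → EReal}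
    (gφ : EuclideanSpace ℝ (Fin n) → EuclideanSpace ℝ (Fin n)) (hp : ProperFn φ)
    (hlsc : LowerSemicontinuous φ) (hco : SuperCoercive φ) {u : EuclideanSpace ℝ (Fin n)} {η : ℝ}
    (haff : ∀ x, ((⟪u, x⟫ + η : ℝ) : EReal) ≤ f x) {lam : ℝ} (hlam : 0 < lam)
    {y : EuclideanSpace ℝ (Fin n)} (hy : y ∈ interior (edom φ)) : benv φ gφ lam f y ≠ ⊥ := by
  obtain ⟨m, hm⟩ := hco.exists_norm_minorant hp hlsc
    (c := ‖gφ y‖ + lam * ‖u‖) (by positivity)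
  obtain ⟨p, hφy⟩ : ∃ p : ℝ, φ y = p :=
    ⟨_, (EReal.coe_toReal (interior_subset hy) (hp.1 y)).symm⟩
  suffices h : ((η + (m - p + ⟪gφ y, y⟫) / lam : ℝ) : EReal) ≤ benv φ gφ lam f y from
    ne_bot_of_le_ne_bot (EReal.coe_ne_bot _) h
  refine le_iInf fun x => ?_
  refine le_trans ?_ (add_le_add_left (haff x) _)
  rw [bregman, if_pos hy, hφy]
  by_cases hx : φ x = ⊤
  · rw [hx, EReal.top_sub_coe, EReal.top_sub_coe,
      EReal.coe_mul_top_of_pos (one_div_pos.2 hlam), EReal.coe_add_top]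
    exact le_top
  obtain ⟨t, ht⟩ : ∃ t : ℝ, φ x = t := ⟨_, (EReal.coe_toReal hx (hp.1 x)).symm⟩
  have hmx := hm x
  rw [ht, EReal.coe_le_coe_iff] at hmx
  rw [ht]
  norm_cast
  have h₁ := real_inner_le_norm (gφ y) x
  have h₂ := (abs_le.1 (abs_real_inner_le_norm u x)).1
  rw [inner_sub_right]
  have h₃ : lam * ⟪u, x⟫ + (t - p - (⟪gφ y, x⟫ - ⟪gφ y, y⟫)) ≥ m - p + ⟪gφ y, y⟫ := by
    nlinarith [mul_le_mul_of_nonneg_left h₂ hlam.le]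
  have h₄ : ⟪u, x⟫ + η + 1 / lam * (t - p - (⟪gφ y, x⟫ - ⟪gφ y, y⟫)) =
      η + (lam * ⟪u, x⟫ + (t - p - (⟪gφ y, x⟫ - ⟪gφ y, y⟫))) / lam := by
    field_simp
    ring
  rw [h₄]
  gcongr

/-- The left Bregman envelope is below `⊤` on `int (dom φ)` once `dom f` meets `dom φ`. -/
theorem benv_ne_top {n : ℕ} {φ f : EuclideanSpace ℝ (Fin n) → EReal}
    (gφ : EuclideanSpace ℝ (Fin n) → EuclideanSpace ℝ (Fin n)) (hp : ProperFn φ)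
    (hdom : (edom f ∩ edom φ).Nonempty) (lam : ℝ)
    {y : EuclideanSpace ℝ (Fin n)} (hy : y ∈ interior (edom φ)) : benv φ gφ lam f y ≠ ⊤ := by
  obtain ⟨x, hfx, hφx⟩ := hdom
  refine ne_top_of_le_ne_top ?_ (iInf_le _ x)
  rw [bregman, if_pos hy, ← EReal.coe_toReal hφx (hp.1 x),
    ← EReal.coe_toReal (interior_subset hy) (hp.1 y), ← EReal.coe_sub, ← EReal.coe_sub,
    ← EReal.coe_mul]
  exact EReal.add_ne_top hfx (EReal.coe_ne_top _)

theorem proxThreshold_eq_top_of_forall {n : ℕ} {φ f : EuclideanSpace ℝ (Fin n) → EReal}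
    {gφ : EuclideanSpace ℝ (Fin n) → EuclideanSpace ℝ (Fin n)}
    (h : ∀ lam : ℝ, 0 < lam → ∃ x, benv φ gφ lam f x ≠ ⊥) : proxThreshold φ gφ f = ⊤ := by
  refine EReal.eq_top_iff_forall_lt _ |>.2 fun c => ?_
  have hpos : 0 < |c| + 1 := by positivity
  refine lt_of_lt_of_le (EReal.coe_lt_coe_iff.2 ?_) (le_sSup ⟨|c| + 1, ⟨hpos, h _ hpos⟩, rfl⟩)
  linarith [le_abs_self c]

theorem proxThreshold_eq_top_of_affine_minorant {n : ℕ}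
    (φ : EuclideanSpace ℝ (Fin n) → EReal)
    (gφ : EuclideanSpace ℝ (Fin n) → EuclideanSpace ℝ (Fin n))
    (hφ : IsLegendre φ gφ) (hφco : SuperCoercive φ)
    (f : EuclideanSpace ℝ (Fin n) → EReal)
    (hfp : ProperFn f)
    (hdom : (edom f ∩ edom φ).Nonempty)
    (u : EuclideanSpace ℝ (Fin n)) (η : ℝ)
    (haff : ∀ x, ((⟪u, x⟫ + η : ℝ) : EReal) ≤ f x) :
    proxThreshold φ gφ f = ⊤ ∧
    (∀ lam : ℝ, 0 < lam → ∃ x, benv φ gφ lam f x ≠ ⊥ ∧ benv φ gφ lam f x ≠ ⊤) ∧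
    (∀ g : EuclideanSpace ℝ (Fin n) → EReal, Gamma0 g → (edom g ∩ edom φ).Nonempty →
      proxThreshold φ gφ g = ⊤) := by
  obtain ⟨y, hy⟩ := hφ.intNonempty
  refine ⟨proxThreshold_eq_top_of_forall fun lam hlam => ⟨y, ?_⟩,
    fun lam hlam => ⟨y, ?_, benv_ne_top gφ hφ.proper hdom lam hy⟩, fun g hg _ => ?_⟩
  · exact benv_ne_bot_of_affine_minorant gφ hφ.proper hφ.lsc hφco haff hlam hy
  · exact benv_ne_bot_of_affine_minorant gφ hφ.proper hφ.lsc hφco haff hlam hy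
  · obtain ⟨v, ζ, hv⟩ := hg.exists_affine_minorant
    exact proxThreshold_eq_top_of_forall fun lam hlam =>
      ⟨y, benv_ne_bot_of_affine_minorant gφ hφ.proper hφ.lsc hφco hv hlam hy⟩

end
end

section
/- Let f ∈ Γ₀(ℝⁿ) with dom f ∩ U ≠ ∅, and let λ > 0. Then for every y ∈ U, prox^φ_λ f(y) = (∇φ + λ∂f)^{-1}(∇φ(y)) = ((1/λ)∇φ + ∂f)^{-1}((1/λ)∇φ(y)), where ∂f is the convex subdifferential; in particular prox^φ_λ f is single-valued and continuous on U. -/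
open scoped RealInnerProductSpace Pointwise Topology Classical

noncomputable section

theorem nonneg_of_hasDerivAt_of_eventually_le {q : ℝ → ℝ} {q' a : ℝ} (hq : HasDerivAt q q' a)
    (h : ∀ᶠ t in 𝓝[>] a, q a ≤ q t) : 0 ≤ q' := by
  refine ge_of_tendsto ((hasDerivWithinAt_iff_tendsto_slope' (s := Set.Ioi a)
    Set.self_notMem_Ioi).1 hq.hasDerivWithinAt) ?_
  filter_upwards [h, self_mem_nhdsWithin] with t ht hta
  rw [slope_def_field]
  exact div_nonneg (sub_nonneg.2 ht) (sub_nonneg.2 (le_of_lt hta))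

theorem HasGradientAt.hasDerivAt_lineMap {E : Type*} [NormedAddCommGroup E]
    [InnerProductSpace ℝ E] [CompleteSpace E] {P : E → ℝ} {g x : E} (hg : HasGradientAt P g x)
    (v : E) : HasDerivAt (fun t : ℝ => P (x + t • v)) (inner ℝ g v) 0 := by
  have hline : HasDerivAt (fun t : ℝ => x + t • v) v 0 := by
    simpa using ((hasDerivAt_id (0 : ℝ)).smul_const v).const_add x
  have hP : HasFDerivAt P ((InnerProductSpace.toDual ℝ E) g) (x + (0 : ℝ) • v) := by
    simpa using hg.hasFDerivAt
  exact hP.comp_hasDerivAt (0 : ℝ) hline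

/-- The point at parameter `t` on the segment from `x` to `z`, as a convex combination. -/
theorem add_smul_sub_eq_combo {E : Type*} [AddCommGroup E] [Module ℝ E] (x z : E) (t : ℝ) :
    x + t • (z - x) = (1 - t) • x + t • z := by
  module

theorem ConvexOn.apply_add_smul_sub_le {E : Type*} [AddCommGroup E] [Module ℝ E] {D : Set E} {P : E → ℝ}
    (hP : ConvexOn ℝ D P) {x z : E} (hx : x ∈ D) (hz : z ∈ D) {t : ℝ} (h0 : 0 ≤ t) (h1 : t ≤ 1) :
    P (x + t • (z - x)) ≤ (1 - t) * P x + t * P z := by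
  rw [add_smul_sub_eq_combo]
  exact hP.2 hx hz (sub_nonneg.2 h1) h0 (by ring)

/-- Gradient inequality for a convex function at a point of differentiability. -/
theorem ConvexOn.add_inner_gradient_le {E : Type*} [NormedAddCommGroup E]
    [InnerProductSpace ℝ E] [CompleteSpace E] {D : Set E} {P : E → ℝ} (hP : ConvexOn ℝ D P)
    {g x z : E} (hx : x ∈ D) (hz : z ∈ D) (hg : HasGradientAt P g x) :
    P x + inner ℝ g (z - x) ≤ P z := by
  have hq : HasDerivAt (fun t : ℝ => (1 - t) * P x + t * P z - P (x + t • (z - x)))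
      (P z - P x - inner ℝ g (z - x)) 0 := by
    have h := ((((hasDerivAt_id (0 : ℝ)).const_sub 1).mul_const (P x)).add
      ((hasDerivAt_id (0 : ℝ)).mul_const (P z))).sub (hg.hasDerivAt_lineMap (z - x))
    have e : -1 * P x + 1 * P z - inner ℝ g (z - x) = P z - P x - inner ℝ g (z - x) := by ring
    exact e ▸ h
  have := nonneg_of_hasDerivAt_of_eventually_le hq ?_
  · linarith
  · filter_upwards [Ioo_mem_nhdsGT (zero_lt_one' ℝ)] with t ht
    have := hP.apply_add_smul_sub_le hx hz ht.1.le ht.2.le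
    simp only [zero_smul, add_zero]
    linarith

/-- The gradient of a differentiable convex function on an open set is continuous. -/
theorem ConvexOn.continuousOn_gradient {E : Type*} [NormedAddCommGroup E]
    [InnerProductSpace ℝ E] [CompleteSpace E] {U : Set E} (hU : IsOpen U) {P : E → ℝ}
    (hP : ConvexOn ℝ U P) {G : E → E} (hG : ∀ x ∈ U, HasGradientAt P (G x) x) :
    ContinuousOn G U := by
  intro y hy
  refine ContinuousAt.continuousWithinAt ?_
  rw [Metric.continuousAt_iff]
  intro ε hε
  have hlo := (hasGradientAt_iff_isLittleO.1 (hG y hy)).def (c := ε / 4) (by positivity)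
  obtain ⟨r, hr, hball⟩ := Metric.eventually_nhds_iff.1 (hlo.and (hU.mem_nhds hy))
  refine ⟨r / 4, by positivity, fun y' hy' => ?_⟩
  rw [dist_eq_norm] at hy'
  set w := G y' - G y with hw
  rw [dist_eq_norm, ← hw]
  by_contra hcon
  push Not at hcon
  have hwpos : 0 < ‖w‖ := hε.trans_le hcon
  set s : ℝ := r / 4 / ‖w‖ with hs
  have hsw : ‖s • w‖ = r / 4 := by
    rw [norm_smul, Real.norm_of_nonneg (by positivity), hs]
    field_simp
  have hz : ‖y' + s • w - y‖ ≤ r / 2 := by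
    have : y' + s • w - y = (y' - y) + s • w := by abel
    rw [this]
    exact (norm_add_le _ _).trans (by linarith)
  have hy'U : y' ∈ U := (hball (by rw [dist_eq_norm]; linarith)).2
  obtain ⟨hzlo, hzU⟩ := hball (y := y' + s • w) (by rw [dist_eq_norm]; linarith)
  have h1 := hP.add_inner_gradient_le hy'U hzU (hG y' hy'U)
  have h2 := hP.add_inner_gradient_le hy hy'U (hG y hy)
  have h3 := (Real.le_norm_self _).trans hzlo
  have e1 : inner ℝ (G y) (y' + s • w - y) = inner ℝ (G y) (y' - y) + s * inner ℝ (G y) w := by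
    rw [← inner_smul_right, ← inner_add_right]
    congr 1
    abel
  have e2 : inner ℝ (G y') (y' + s • w - y') = s * inner ℝ (G y) w + s * ‖w‖ ^ 2 := by
    rw [add_sub_cancel_left, inner_smul_right, ← mul_add, ← real_inner_self_eq_norm_sq,
      ← inner_add_left, hw, add_sub_cancel]
  have e3 : s * ‖w‖ ^ 2 = r / 4 * ‖w‖ := by
    rw [hs]
    field_simp
  have h4 : ε / 4 * ‖y' + s • w - y‖ ≤ ε / 4 * (r / 2) := by gcongr
  have h5 : r / 4 * ε ≤ r / 4 * ‖w‖ := by gcongr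
  have : 0 < r * ε := by positivity
  rw [e1] at h3
  rw [e2] at h1
  linarith

theorem ProperFn.coe_toReal {n : ℕ} {f : EuclideanSpace ℝ (Fin n) → EReal} (hf : ProperFn f)
    {x : EuclideanSpace ℝ (Fin n)} (hx : x ∈ edom f) : ((f x).toReal : EReal) = f x :=
  EReal.coe_toReal hx (hf.1 x)

theorem notMem_edom {n : ℕ} {f : EuclideanSpace ℝ (Fin n) → EReal}
    {x : EuclideanSpace ℝ (Fin n)} : x ∉ edom f ↔ f x = ⊤ :=
  not_not

theorem ConvexFn.convexOn_toReal {n : ℕ} {f : EuclideanSpace ℝ (Fin n) → EReal}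
    (hf : ConvexFn f) (hp : ProperFn f) : ConvexOn ℝ (edom f) (fun x => (f x).toReal) := by
  have key : ∀ x ∈ edom f, ∀ y ∈ edom f, ∀ a b : ℝ, 0 ≤ a → 0 ≤ b → a + b = 1 →
      f (a • x + b • y) ≤ ((a * (f x).toReal + b * (f y).toReal : ℝ) : EReal) := by
    intro x hx y hy a b ha hb hab
    have := hf x y a b ha hb hab
    rw [← hp.coe_toReal hx, ← hp.coe_toReal hy] at this
    exact_mod_cast this
  have hmem : ∀ x ∈ edom f, ∀ y ∈ edom f, ∀ a b : ℝ, 0 ≤ a → 0 ≤ b → a + b = 1 →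
      a • x + b • y ∈ edom f := fun x hx y hy a b ha hb hab =>
    ((key x hx y hy a b ha hb hab).trans_lt (EReal.coe_lt_top _)).ne
  refine ⟨fun x hx y hy a b ha hb hab => hmem x hx y hy a b ha hb hab,
    fun x hx y hy a b ha hb hab => ?_⟩
  have := key x hx y hy a b ha hb hab
  rw [← hp.coe_toReal (hmem x hx y hy a b ha hb hab)] at this
  exact_mod_cast this

/-- A proper lower semicontinuous function attains its infimum on a compact set. -/
theorem exists_isMinOn_toReal {n : ℕ} {G : EuclideanSpace ℝ (Fin n) → EReal}
    (hbot : ∀ x, G x ≠ ⊥) (hG : LowerSemicontinuous G) {K : Set (EuclideanSpace ℝ (Fin n))}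
    (hK : IsCompact K) (hne : (K ∩ edom G).Nonempty) :
    ∃ x ∈ K ∩ edom G, IsMinOn (fun z => (G z).toReal) (K ∩ edom G) x := by
  obtain ⟨x₀, hx₀K, hx₀⟩ := hne
  obtain ⟨x, hxK, hx⟩ := (hG.lowerSemicontinuousOn K).exists_isMinOn ⟨x₀, hx₀K⟩ hK
  have hxG : x ∈ edom G := ((hx hx₀K).trans_lt (lt_top_iff_ne_top.2 hx₀)).ne
  exact ⟨x, ⟨hxK, hxG⟩, fun z hz => EReal.toReal_le_toReal (hx hz.1) (hbot x) hz.2⟩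

/-- A proper, lower semicontinuous, convex function decreases at most linearly. -/
theorem Gamma0.exists_linear_lower_bound {n : ℕ} {f : EuclideanSpace ℝ (Fin n) → EReal}
    (hf : Gamma0 f) : ∃ K : ℝ, 0 ≤ K ∧ ∀ x ∈ edom f, -(K * (1 + ‖x‖)) ≤ (f x).toReal := by
  obtain ⟨hp, hlsc, hc⟩ := hf
  have hconv := hc.convexOn_toReal hp
  obtain ⟨x₀, hx₀⟩ := hp.2
  obtain ⟨p, ⟨-, -⟩, hmin⟩ := exists_isMinOn_toReal hp.1 hlsc
    (isCompact_closedBall x₀ 1) ⟨x₀, Metric.mem_closedBall_self zero_le_one, hx₀⟩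
  set F := fun x => (f x).toReal with hF
  set m := F p with hm
  have hmx₀ : 0 ≤ F x₀ - m :=
    sub_nonneg.2 (hmin ⟨Metric.mem_closedBall_self zero_le_one, hx₀⟩)
  have bound : ∀ x ∈ edom f, m - (F x₀ - m) * ‖x - x₀‖ ≤ F x := by
    intro x hx
    rcases le_total ‖x - x₀‖ 1 with h | h
    · have h1 : m ≤ F x := hmin ⟨by simpa [dist_eq_norm] using h, hx⟩
      have := mul_nonneg hmx₀ (norm_nonneg (x - x₀))
      linarith
    · set d := ‖x - x₀‖ with hd
      have hd0 : 0 < d := by linarith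
      have hinv : d⁻¹ ≤ 1 := inv_le_one_of_one_le₀ h
      have h1 := hconv.apply_add_smul_sub_le hx₀ hx (inv_nonneg.2 hd0.le) hinv
      have hmem : x₀ + d⁻¹ • (x - x₀) ∈ Metric.closedBall x₀ 1 ∩ edom f := by
        refine ⟨?_, ?_⟩
        · rw [Metric.mem_closedBall, dist_eq_norm, add_sub_cancel_left, norm_smul,
            Real.norm_of_nonneg (by positivity), ← hd, inv_mul_cancel₀ hd0.ne']
        · rw [add_smul_sub_eq_combo]
          exact hconv.1 hx₀ hx (sub_nonneg.2 hinv) (by positivity) (by ring)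
      have h2 : m ≤ (1 - d⁻¹) * F x₀ + d⁻¹ * F x := (hmin hmem).trans h1
      have h3 := mul_le_mul_of_nonneg_left h2 hd0.le
      have h4 : d * ((1 - d⁻¹) * F x₀ + d⁻¹ * F x) = (d - 1) * F x₀ + F x := by
        field_simp
      nlinarith
  refine ⟨|m| + (F x₀ - m) * (1 + ‖x₀‖), by positivity, fun x hx => ?_⟩
  refine le_trans ?_ (bound x hx)
  have h1 : (F x₀ - m) * ‖x - x₀‖ ≤ (F x₀ - m) * (‖x‖ + ‖x₀‖) := by
    gcongr
    exact norm_sub_le _ _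
  have h2 := neg_abs_le m
  have h3 : 0 ≤ |m| * ‖x‖ := by positivity
  have h4 : 0 ≤ (F x₀ - m) * (1 + ‖x₀‖ * ‖x‖) := by positivity
  nlinarith

/-- The objective of the Bregman proximal problem, up to scaling and additive constants. -/
def tilted {n : ℕ} (φ f : EuclideanSpace ℝ (Fin n) → EReal) (lam : ℝ)
    (g z : EuclideanSpace ℝ (Fin n)) : ℝ :=
  lam * (f z).toReal + (φ z).toReal - inner ℝ g z

theorem tilted_add_smul_sub_le {n : ℕ} {φ f : EuclideanSpace ℝ (Fin n) → EReal}
    (hφ : ConvexOn ℝ (edom φ) fun x => (φ x).toReal)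
    (hf : ConvexOn ℝ (edom f) fun x => (f x).toReal) {lam : ℝ} (hlam : 0 < lam)
    (g : EuclideanSpace ℝ (Fin n)) {x z : EuclideanSpace ℝ (Fin n)} (hx : x ∈ edom f ∩ edom φ)
    (hz : z ∈ edom f ∩ edom φ) {t : ℝ} (h0 : 0 ≤ t) (h1 : t ≤ 1) :
    tilted φ f lam g (x + t • (z - x)) ≤ (1 - t) * tilted φ f lam g x + t * tilted φ f lam g z := by
  have hF := mul_le_mul_of_nonneg_left (hf.apply_add_smul_sub_le hx.1 hz.1 h0 h1) hlam.le
  have hP := hφ.apply_add_smul_sub_le hx.2 hz.2 h0 h1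
  simp only [tilted, inner_add_right, inner_smul_right, inner_sub_right]
  linarith

theorem exists_isMinOn_tilted {n : ℕ} {φ f : EuclideanSpace ℝ (Fin n) → EReal}
    (hφ : ProperFn φ) (hφl : LowerSemicontinuous φ) (hf : ProperFn f)
    (hfl : LowerSemicontinuous f) {lam : ℝ} (hlam : 0 < lam) (g : EuclideanSpace ℝ (Fin n))
    {K : Set (EuclideanSpace ℝ (Fin n))} (hK : IsCompact K)
    (hne : (K ∩ (edom f ∩ edom φ)).Nonempty) :
    ∃ x ∈ K ∩ (edom f ∩ edom φ), IsMinOn (tilted φ f lam g) (K ∩ (edom f ∩ edom φ)) x := by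
  set G : EuclideanSpace ℝ (Fin n) → EReal := fun z =>
    (lam : EReal) * f z + φ z + ((-inner ℝ g z : ℝ) : EReal) with hG
  have hmul : Continuous fun c : EReal => (lam : EReal) * c := by
    refine continuous_iff_continuousAt.2 fun c => ?_
    have hne0 : (lam : EReal) ≠ 0 := by exact_mod_cast hlam.ne'
    exact (EReal.continuousAt_mul (p := ((lam : EReal), c)) (.inl hne0) (.inl hne0)
      (.inl (EReal.coe_ne_bot _)) (.inl (EReal.coe_ne_top _))).comp
      (f := fun c : EReal => ((lam : EReal), c)) (by fun_prop)
  have hfbot : ∀ z, (lam : EReal) * f z ≠ ⊥ := by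
    intro z
    by_cases hz : z ∈ edom f
    · rw [← hf.coe_toReal hz, ← EReal.coe_mul]
      exact EReal.coe_ne_bot _
    · rw [notMem_edom.1 hz, EReal.coe_mul_top_of_pos hlam]
      exact top_ne_bot
  have hsum : ∀ z, (lam : EReal) * f z + φ z ≠ ⊥ := fun z =>
    EReal.add_ne_bot_iff.2 ⟨hfbot z, hφ.1 z⟩
  have hbot : ∀ z, G z ≠ ⊥ := fun z => EReal.add_ne_bot_iff.2 ⟨hsum z, EReal.coe_ne_bot _⟩
  have hlin : Continuous fun z : EuclideanSpace ℝ (Fin n) => ((-inner ℝ g z : ℝ) : EReal) :=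
    continuous_coe_real_ereal.comp (by fun_prop)
  have hlsc : LowerSemicontinuous G := by
    refine LowerSemicontinuous.add' (LowerSemicontinuous.add' ?_ hφl fun z => ?_)
      hlin.lowerSemicontinuous fun z => ?_
    · exact hmul.comp_lowerSemicontinuous hfl fun a b hab =>
        mul_le_mul_of_nonneg_left hab (by exact_mod_cast hlam.le)
    · exact EReal.continuousAt_add (.inr (hφ.1 z)) (.inl (hfbot z))
    · exact EReal.continuousAt_add (.inr (EReal.coe_ne_bot _)) (.inr (EReal.coe_ne_top _))
  have hval : ∀ z ∈ edom f ∩ edom φ, G z = (tilted φ f lam g z : EReal) := by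
    rintro z ⟨hzf, hzφ⟩
    simp only [hG, tilted]
    rw [← hf.coe_toReal hzf, ← hφ.coe_toReal hzφ]
    norm_cast
  have hdom : edom G = edom f ∩ edom φ := by
    ext z
    refine ⟨fun hz => ?_, fun hz => ?_⟩
    · refine ⟨fun hzf => hz ?_, fun hzφ => hz ?_⟩
      · simp only [hG, hzf, EReal.coe_mul_top_of_pos hlam, EReal.top_add_of_ne_bot (hφ.1 z),
          EReal.top_add_coe]
      · simp only [hG, hzφ, EReal.add_top_of_ne_bot (hfbot z), EReal.top_add_coe]
    · change G z ≠ ⊤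
      rw [hval z hz]
      exact EReal.coe_ne_top _
  obtain ⟨x, hx, hmin⟩ := exists_isMinOn_toReal hbot hlsc hK (by rwa [hdom])
  rw [hdom] at hx hmin
  refine ⟨x, hx, fun z hz => ?_⟩
  have : (G x).toReal ≤ (G z).toReal := hmin hz
  rwa [hval z hz.2, hval x hx.2, EReal.toReal_coe, EReal.toReal_coe] at this

theorem mem_bprox_iff {n : ℕ} {φ f : EuclideanSpace ℝ (Fin n) → EReal}
    {gφ : EuclideanSpace ℝ (Fin n) → EuclideanSpace ℝ (Fin n)} (hφ : ProperFn φ)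
    (hf : ProperFn f) {lam : ℝ} (hlam : 0 < lam)
    {x y : EuclideanSpace ℝ (Fin n)} (hy : y ∈ interior (edom φ)) :
    x ∈ bprox φ gφ lam f y ↔ x ∈ edom f ∩ edom φ ∧
      IsMinOn (tilted φ f lam (gφ y)) (edom f ∩ edom φ) x := by
  have hinv : 0 < 1 / lam := by positivity
  set c : ℝ := 1 / lam * (inner ℝ (gφ y) y - (φ y).toReal) with hc
  set obj : EuclideanSpace ℝ (Fin n) → EReal := fun z =>
    f z + ((1 / lam : ℝ) : EReal) * bregman φ gφ z y with hobj
  have hval : ∀ z ∈ edom f ∩ edom φ,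
      obj z = ((1 / lam * tilted φ f lam (gφ y) z + c : ℝ) : EReal) := by
    rintro z ⟨hzf, hzφ⟩
    simp only [hobj, bregman, if_pos hy]
    rw [← hf.coe_toReal hzf, ← hφ.coe_toReal hzφ, ← hφ.coe_toReal (interior_subset hy)]
    rw [← EReal.coe_sub, ← EReal.coe_sub, ← EReal.coe_mul, ← EReal.coe_add]
    congr 1
    simp only [tilted, hc, inner_sub_right]
    field_simp
    ring
  have hfin : ∀ z, obj z ≠ ⊤ → z ∈ edom f ∩ edom φ := by
    intro z hz
    have hzφ : z ∈ edom φ := by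
      intro htop
      refine hz ?_
      simp only [hobj, bregman, if_pos hy, htop]
      rw [← hφ.coe_toReal (interior_subset hy), EReal.top_sub_coe, EReal.top_sub_coe,
        EReal.coe_mul_top_of_pos hinv, EReal.add_top_of_ne_bot (hf.1 z)]
    refine ⟨fun htop => hz ?_, hzφ⟩
    simp only [hobj, bregman, if_pos hy, htop]
    rw [← hφ.coe_toReal (interior_subset hy), ← hφ.coe_toReal hzφ, ← EReal.coe_sub,
      ← EReal.coe_sub, ← EReal.coe_mul, EReal.top_add_coe]
  have hle : ∀ w ∈ edom f ∩ edom φ, ∀ z ∈ edom f ∩ edom φ,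
      (obj w ≤ obj z ↔ tilted φ f lam (gφ y) w ≤ tilted φ f lam (gφ y) z) := by
    intro w hw z hz
    rw [hval w hw, hval z hz, EReal.coe_le_coe_iff, add_le_add_iff_right,
      mul_le_mul_iff_right₀ hinv]
  constructor
  · rintro ⟨htop, hmin⟩
    have hx := hfin x htop
    exact ⟨hx, fun z hz => (hle x hx z hz).1 (hmin z)⟩
  · rintro ⟨hx, hmin⟩
    refine ⟨?_, fun z => ?_⟩
    · change obj x ≠ ⊤
      rw [hval x hx]
      exact EReal.coe_ne_top _
    · change obj x ≤ obj z
      by_cases hz : obj z = ⊤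
      · rw [hz]
        exact le_top
      · exact (hle x hx z (hfin z hz)).2 (hmin (hfin z hz))

theorem mem_subdiff_iff {n : ℕ} {f : EuclideanSpace ℝ (Fin n) → EReal} (hf : ProperFn f)
    {x u : EuclideanSpace ℝ (Fin n)} :
    u ∈ subdiff f x ↔
      x ∈ edom f ∧ ∀ z ∈ edom f, (f x).toReal + inner ℝ u (z - x) ≤ (f z).toReal := by
  constructor
  · intro hu
    have hx : x ∈ edom f := by
      intro htop
      obtain ⟨z, hz⟩ := hf.2
      have := hu z
      rw [htop, EReal.top_add_coe, top_le_iff] at this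
      exact hz this
    refine ⟨hx, fun z hz => ?_⟩
    have := hu z
    rw [← hf.coe_toReal hx, ← hf.coe_toReal hz] at this
    exact_mod_cast this
  · rintro ⟨hx, h⟩ z
    by_cases hz : z ∈ edom f
    · rw [← hf.coe_toReal hx, ← hf.coe_toReal hz]
      exact_mod_cast h z hz
    · rw [notMem_edom.1 hz]
      exact le_top

/-- Essential smoothness keeps the minimizers away from the boundary of the domain. -/
theorem IsLegendre.mem_interior_of_isMinOn_tilted {n : ℕ}
    {φ f : EuclideanSpace ℝ (Fin n) → EReal}
    {gφ : EuclideanSpace ℝ (Fin n) → EuclideanSpace ℝ (Fin n)} (hφ : IsLegendre φ gφ)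
    (hf : Gamma0 f) (hdom : (edom f ∩ interior (edom φ)).Nonempty) {lam : ℝ} (hlam : 0 < lam)
    {g x : EuclideanSpace ℝ (Fin n)} (hx : x ∈ edom f ∩ edom φ)
    (hmin : IsMinOn (tilted φ f lam g) (edom f ∩ edom φ) x) : x ∈ interior (edom φ) := by
  by_contra hxU
  have hcF := hf.2.2.convexOn_toReal hf.1
  have hcP := hφ.convex.convexOn_toReal hφ.proper
  obtain ⟨x₀, hx₀f, hx₀U⟩ := hdom
  set P := fun z => (φ z).toReal with hP
  set v := x₀ - x with hv
  have hseg : ∀ t : ℝ, 0 < t → t ≤ 1 → x + t • v ∈ edom f ∩ interior (edom φ) := by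
    intro t h0 h1
    rw [hv, add_smul_sub_eq_combo]
    exact ⟨hcF.1 hx.1 hx₀f (sub_nonneg.2 h1) h0.le (by ring),
      hcP.1.combo_self_interior_mem_interior hx.2 hx₀U (sub_nonneg.2 h1) h0 (by ring)⟩
  set C : ℝ := |lam * ((f x₀).toReal - (f x).toReal) - inner ℝ g v| with hC
  have hlow : ∀ t : ℝ, 0 < t → t ≤ 1 → P x - t * C ≤ P (x + t • v) := by
    intro t h0 h1
    have hm : tilted φ f lam g x ≤ tilted φ f lam g (x + t • v) :=
      hmin ⟨(hseg t h0 h1).1, interior_subset (hseg t h0 h1).2⟩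
    have hc := mul_le_mul_of_nonneg_left (hcF.apply_add_smul_sub_le hx.1 hx₀f h0.le h1) hlam.le
    have hab := mul_le_mul_of_nonneg_left
      (le_abs_self (lam * ((f x₀).toReal - (f x).toReal) - inner ℝ g v)) h0.le
    rw [← hC] at hab
    simp only [tilted, inner_add_right, inner_smul_right] at hm
    change P x - t * C ≤ P (x + t • v)
    simp only [hP]
    linarith
  have hslope : ∀ t : ℝ, 0 < t → t ≤ 1 → -C ≤ inner ℝ (gφ (x + t • v)) v := by
    intro t h0 h1
    have hU := (hseg t h0 h1).2
    have h2 := hcP.add_inner_gradient_le (interior_subset hU) hx.2 (hφ.grad _ hU)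
    have e : x - (x + t • v) = -(t • v) := by abel
    rw [e, inner_neg_right, inner_smul_right] at h2
    have h3 := hlow t h0 h1
    have h4 : t * -C ≤ t * inner ℝ (gφ (x + t • v)) v := by
      simp only [hP] at h3
      linarith
    exact le_of_mul_le_mul_left h4 h0
  have hcont : ContinuousAt P x₀ := (hφ.grad x₀ hx₀U).hasFDerivAt.continuousAt
  obtain ⟨r, hr, hball⟩ := Metric.eventually_nhds_iff.1
    ((hcont.eventually_le_const (lt_add_one (P x₀))).and (isOpen_interior.mem_nhds hx₀U))
  set B : ℝ := (P x₀ + 1 - P x + 2 * C) / (r / 2) with hB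
  have hC0 : 0 ≤ C := abs_nonneg _
  have hbound : ∀ t : ℝ, 0 < t → t ≤ 1 → ‖gφ (x + t • v)‖ ≤ B := by
    intro t h0 h1
    set w := gφ (x + t • v) with hw
    have hU := (hseg t h0 h1).2
    set s : ℝ := r / 2 / ‖w‖ with hs
    have hnorm : ‖s • w‖ ≤ r / 2 := by
      rw [norm_smul, Real.norm_of_nonneg (by positivity), hs]
      rcases eq_or_ne ‖w‖ 0 with h | h
      · rw [h, mul_zero]
        positivity
      · rw [div_mul_cancel₀ _ h]
    have hinn : s * ‖w‖ ^ 2 = r / 2 * ‖w‖ := by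
      rcases eq_or_ne ‖w‖ 0 with h | h
      · simp [h]
      · rw [hs]
        field_simp
    obtain ⟨hPz, hzU⟩ := hball (y := x₀ + s • w)
      (by rw [dist_eq_norm, add_sub_cancel_left]; linarith)
    have h2 := hcP.add_inner_gradient_le (interior_subset hU) (interior_subset hzU)
      (hφ.grad _ hU)
    have e : x₀ + s • w - (x + t • v) = s • w + (1 - t) • v := by
      rw [hv]
      module
    rw [e, ← hw, inner_add_right, inner_smul_right, inner_smul_right, real_inner_self_eq_norm_sq,
      hinn] at h2
    have h3 := mul_le_mul_of_nonneg_left (hslope t h0 h1) (sub_nonneg.2 h1)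
    rw [← hw] at h3
    have h4 := hlow t h0 h1
    rw [hB, le_div_iff₀ (by positivity)]
    have h2' : P (x + t • v) + (r / 2 * ‖w‖ + (1 - t) * inner ℝ w v) ≤ P (x₀ + s • w) := h2
    linarith
  set τ : ℕ → ℝ := fun k => 1 / ((k : ℝ) + 1) with hτ
  have hτ0 : ∀ k, 0 < τ k := fun k => Nat.one_div_pos_of_nat
  have hτ1 : ∀ k, τ k ≤ 1 := fun k => by
    rw [hτ, div_le_one (by positivity)]
    linarith [(Nat.cast_nonneg k : (0 : ℝ) ≤ k)]
  have hlim : Filter.Tendsto (fun k => x + τ k • v) Filter.atTop (𝓝 x) := by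
    have hτlim : Filter.Tendsto τ Filter.atTop (𝓝 0) := tendsto_one_div_add_atTop_nhds_zero_nat
    simpa using (hτlim.smul_const v).const_add x
  have hblow := hφ.essSmooth (fun k => x + τ k • v) x
    (fun k => (hseg _ (hτ0 k) (hτ1 k)).2) ⟨subset_closure hx.2, hxU⟩ hlim
  obtain ⟨k, hk⟩ := (hblow.eventually_gt_atTop B).exists
  exact absurd (hbound _ (hτ0 k) (hτ1 k)) (not_le.2 hk)

/-- Fermat's rule at an interior minimizer. -/
theorem smul_sub_mem_subdiff_of_isMinOn_tilted {n : ℕ} {φ f : EuclideanSpace ℝ (Fin n) → EReal}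
    {gx g x : EuclideanSpace ℝ (Fin n)} (hf : Gamma0 f) {lam : ℝ} (hlam : 0 < lam)
    (hgx : HasGradientAt (fun z => (φ z).toReal) gx x) (hx : x ∈ edom f)
    (hxU : x ∈ interior (edom φ))
    (hmin : IsMinOn (tilted φ f lam g) (edom f ∩ edom φ) x) :
    (1 / lam) • (g - gx) ∈ subdiff f x := by
  have hcF := hf.2.2.convexOn_toReal hf.1
  refine (mem_subdiff_iff hf.1).2 ⟨hx, fun z hz => ?_⟩
  set v := z - x with hv
  have hq : HasDerivAt (fun t : ℝ => t * (lam * ((f z).toReal - (f x).toReal) - inner ℝ g v)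
      + (φ (x + t • v)).toReal)
      (1 * (lam * ((f z).toReal - (f x).toReal) - inner ℝ g v) + inner ℝ gx v) 0 :=
    ((hasDerivAt_id (0 : ℝ)).mul_const _).add (hgx.hasDerivAt_lineMap v)
  have hev : ∀ᶠ t : ℝ in 𝓝[>] 0, x + t • v ∈ interior (edom φ) := by
    have hc : ContinuousAt (fun t : ℝ => x + t • v) 0 := by fun_prop
    exact (hc.eventually_mem (isOpen_interior.mem_nhds (by simpa using hxU))).filter_mono
      nhdsWithin_le_nhds
  have h := nonneg_of_hasDerivAt_of_eventually_le hq ?_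
  · have h' : inner ℝ g v - inner ℝ gx v ≤ lam * ((f z).toReal - (f x).toReal) := by linarith
    rw [inner_smul_left, inner_sub_left, RCLike.conj_to_real]
    have := mul_le_mul_of_nonneg_left h' (one_div_pos.2 hlam).le
    rw [← mul_assoc, one_div_mul_cancel hlam.ne'] at this
    linarith
  · filter_upwards [hev, Ioo_mem_nhdsGT (zero_lt_one' ℝ)] with t htU ht
    have hmem : x + t • v ∈ edom f := by
      rw [hv, add_smul_sub_eq_combo]
      exact hcF.1 hx hz (sub_nonneg.2 ht.2.le) ht.1.le (by ring)
    have hm : tilted φ f lam g x ≤ tilted φ f lam g (x + t • v) :=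
      hmin ⟨hmem, interior_subset htU⟩
    have hc := mul_le_mul_of_nonneg_left
      (hcF.apply_add_smul_sub_le hx hz ht.1.le ht.2.le) hlam.le
    simp only [tilted, inner_add_right, inner_smul_right] at hm
    simp only [zero_mul, zero_smul, add_zero, zero_add]
    linarith

theorem isMinOn_tilted_of_mem_subdiff {n : ℕ} {φ f : EuclideanSpace ℝ (Fin n) → EReal}
    {gx u x : EuclideanSpace ℝ (Fin n)} (hφ : ConvexOn ℝ (edom φ) fun z => (φ z).toReal)
    (hf : ProperFn f) {lam : ℝ} (hlam : 0 < lam)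
    (hgx : HasGradientAt (fun z => (φ z).toReal) gx x) (hx : x ∈ edom φ)
    (hu : u ∈ subdiff f x) :
    IsMinOn (tilted φ f lam (gx + lam • u)) (edom f ∩ edom φ) x := by
  intro z hz
  have h1 := mul_le_mul_of_nonneg_left (((mem_subdiff_iff hf).1 hu).2 z hz.1) hlam.le
  have h2 := hφ.add_inner_gradient_le hx hz.2 hgx
  rw [inner_sub_right] at h1 h2
  change tilted φ f lam _ x ≤ tilted φ f lam _ z
  simp only [tilted, inner_add_left, inner_smul_left, RCLike.conj_to_real]
  linarith

theorem IsLegendre.eq_of_isMinOn_tilted {n : ℕ} {φ f : EuclideanSpace ℝ (Fin n) → EReal}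
    {gφ : EuclideanSpace ℝ (Fin n) → EuclideanSpace ℝ (Fin n)} (hφ : IsLegendre φ gφ)
    (hf : Gamma0 f) {lam : ℝ} (hlam : 0 < lam) {g x z : EuclideanSpace ℝ (Fin n)}
    (hx : x ∈ edom f ∩ interior (edom φ)) (hz : z ∈ edom f ∩ interior (edom φ))
    (hxmin : IsMinOn (tilted φ f lam g) (edom f ∩ edom φ) x)
    (hzmin : IsMinOn (tilted φ f lam g) (edom f ∩ edom φ) z) : x = z := by
  by_contra hne
  have hcF := hf.2.2.convexOn_toReal hf.1
  have hcP := hφ.convex.convexOn_toReal hφ.proper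
  have hxφ := interior_subset hx.2
  have hzφ := interior_subset hz.2
  have hsum : (1 / 2 : ℝ) + 1 / 2 = 1 := by norm_num
  have hmφ : (1 / 2 : ℝ) • x + (1 / 2 : ℝ) • z ∈ edom φ :=
    hcP.1 hxφ hzφ (by norm_num) (by norm_num) hsum
  have hmf : (1 / 2 : ℝ) • x + (1 / 2 : ℝ) • z ∈ edom f :=
    hcF.1 hx.1 hz.1 (by norm_num) (by norm_num) hsum
  have hstrict := hφ.essStrictConvex x hx.2 z hz.2 hne (1 / 2) (1 / 2) (by norm_num)
    (by norm_num) hsum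
  rw [← hφ.proper.coe_toReal hmφ, ← hφ.proper.coe_toReal hxφ, ← hφ.proper.coe_toReal hzφ,
    ← EReal.coe_mul, ← EReal.coe_mul, ← EReal.coe_add, EReal.coe_lt_coe_iff] at hstrict
  have hF := mul_le_mul_of_nonneg_left
    (hcF.2 hx.1 hz.1 (by norm_num : (0 : ℝ) ≤ 1 / 2) (by norm_num : (0 : ℝ) ≤ 1 / 2) hsum) hlam.le
  have h1 : tilted φ f lam g x ≤ tilted φ f lam g _ := hxmin ⟨hmf, hmφ⟩
  have h2 : tilted φ f lam g z ≤ tilted φ f lam g _ := hzmin ⟨hmf, hmφ⟩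
  simp only [tilted, inner_add_right, inner_smul_right, smul_eq_mul] at h1 h2 hF
  linarith

theorem exists_isMinOn_tilted_of_superCoercive {n : ℕ}
    {φ f : EuclideanSpace ℝ (Fin n) → EReal} (hφ : ProperFn φ) (hφl : LowerSemicontinuous φ)
    (hφco : SuperCoercive φ) (hf : Gamma0 f) {lam : ℝ} (hlam : 0 < lam)
    (hne : (edom f ∩ edom φ).Nonempty) (g : EuclideanSpace ℝ (Fin n)) :
    ∃ x ∈ edom f ∩ edom φ, IsMinOn (tilted φ f lam g) (edom f ∩ edom φ) x := by
  obtain ⟨x₀, hx₀⟩ := hne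
  obtain ⟨K, hK, hbound⟩ := hf.exists_linear_lower_bound
  obtain ⟨R, hR⟩ := hφco (lam * K + ‖g‖ + 1)
  set ρ := max ‖x₀‖ (max R (lam * K + tilted φ f lam g x₀)) with hρ
  have hx₀ball : x₀ ∈ Metric.closedBall (0 : EuclideanSpace ℝ (Fin n)) ρ := by
    rw [mem_closedBall_zero_iff]
    exact le_max_left _ _
  obtain ⟨x, hx, hmin⟩ := exists_isMinOn_tilted hφ hφl hf.1 hf.2.1 hlam g
    (isCompact_closedBall (0 : EuclideanSpace ℝ (Fin n)) ρ) ⟨x₀, hx₀ball, hx₀⟩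
  refine ⟨x, hx.2, fun z hz => ?_⟩
  by_cases hzb : z ∈ Metric.closedBall (0 : EuclideanSpace ℝ (Fin n)) ρ
  · exact hmin ⟨hzb, hz⟩
  · rw [mem_closedBall_zero_iff, not_le, hρ, max_lt_iff, max_lt_iff] at hzb
    have h0 : tilted φ f lam g x ≤ tilted φ f lam g x₀ := hmin ⟨hx₀ball, hx₀⟩
    have h1 := mul_le_mul_of_nonneg_left (hbound z hz.1) hlam.le
    have h2 := hR z hzb.2.1.le
    rw [← hφ.coe_toReal hz.2, EReal.coe_le_coe_iff] at h2
    have h3 := real_inner_le_norm g z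
    refine h0.trans ?_
    have h4 : lam * (f z).toReal + (φ z).toReal - inner ℝ g z = tilted φ f lam g z := rfl
    linarith [hzb.2.2]

/-- The minimizer of a tilted convex function depends continuously on the tilt. -/
theorem continuous_of_unique_isMinOn_tilted {n : ℕ} {φ f : EuclideanSpace ℝ (Fin n) → EReal}
    (hφ : Gamma0 φ) (hf : Gamma0 f) {lam : ℝ} (hlam : 0 < lam)
    {S : EuclideanSpace ℝ (Fin n) → EuclideanSpace ℝ (Fin n)}
    (hmem : ∀ g, S g ∈ edom f ∩ edom φ)
    (hmin : ∀ g, IsMinOn (tilted φ f lam g) (edom f ∩ edom φ) (S g))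
    (huniq : ∀ g, ∀ x ∈ edom f ∩ edom φ,
      IsMinOn (tilted φ f lam g) (edom f ∩ edom φ) x → x = S g) :
    Continuous S := by
  have hcF := hf.2.2.convexOn_toReal hf.1
  have hcP := hφ.2.2.convexOn_toReal hφ.1
  refine continuous_iff_continuousAt.2 fun g => Metric.continuousAt_iff.2 fun ε hε => ?_
  set D := edom f ∩ edom φ with hD
  have hgap : ∃ δ > 0, ∀ w ∈ Metric.sphere (S g) ε ∩ D,
      tilted φ f lam g (S g) + δ ≤ tilted φ f lam g w := by
    rcases (Metric.sphere (S g) ε ∩ D).eq_empty_or_nonempty with h | h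
    · exact ⟨1, one_pos, by simp [h]⟩
    · obtain ⟨p, hp, hpmin⟩ := exists_isMinOn_tilted hφ.1 hφ.2.1 hf.1 hf.2.1 hlam g
        (isCompact_sphere (S g) ε) h
      refine ⟨tilted φ f lam g p - tilted φ f lam g (S g), sub_pos.2 ?_, fun w hw => ?_⟩
      · by_contra hle
        have hpS := huniq g p hp.2 fun z hz => (not_lt.1 hle).trans (hmin g hz)
        have : dist p (S g) = ε := hp.1
        rw [hpS, dist_self] at this
        exact hε.ne this
      · have : tilted φ f lam g p ≤ tilted φ f lam g w := hpmin hw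
        linarith
  obtain ⟨δ, hδ, hgap⟩ := hgap
  refine ⟨δ / ε, by positivity, fun g' hg' => ?_⟩
  by_contra hcon
  rw [not_lt, dist_eq_norm] at hcon
  set d := ‖S g' - S g‖ with hd
  have hd0 : 0 < d := hε.trans_le hcon
  have ht1 : ε / d ≤ 1 := (div_le_one hd0).2 hcon
  have ht0 : 0 ≤ ε / d := by positivity
  set w := S g + (ε / d) • (S g' - S g) with hw
  have hnorm : ‖w - S g‖ = ε := by
    rw [hw, add_sub_cancel_left, norm_smul, Real.norm_of_nonneg ht0, ← hd,
      div_mul_cancel₀ _ hd0.ne']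
  have hwD : w ∈ D := by
    rw [hw, add_smul_sub_eq_combo]
    exact (hcF.1.inter hcP.1) (hmem g) (hmem g') (sub_nonneg.2 ht1) ht0 (by ring)
  have h1 := hgap w ⟨by rw [mem_sphere_iff_norm, hnorm], hwD⟩
  have h2 := tilted_add_smul_sub_le hcP hcF hlam g' (hmem g) (hmem g') ht0 ht1
  rw [← hw] at h2
  have h3 : tilted φ f lam g' (S g') ≤ tilted φ f lam g' (S g) := hmin g' (hmem g)
  have h4 := mul_le_mul_of_nonneg_left h3 ht0
  have h5 : inner ℝ (g' - g) (w - S g) ≤ ‖g' - g‖ * ε := hnorm ▸ real_inner_le_norm _ _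
  have h6 : ‖g' - g‖ * ε < δ := by
    rwa [dist_eq_norm, lt_div_iff₀ hε] at hg'
  simp only [inner_sub_left, inner_sub_right] at h5
  simp only [tilted] at h1 h2 h4
  linarith

theorem bprox_eq_resolvent_of_convex {n : ℕ}
    (φ : EuclideanSpace ℝ (Fin n) → EReal)
    (gφ : EuclideanSpace ℝ (Fin n) → EuclideanSpace ℝ (Fin n))
    (hφ : IsLegendre φ gφ) (hφco : SuperCoercive φ)
    (f : EuclideanSpace ℝ (Fin n) → EReal) (hf : Gamma0 f)
    (hdom : (edom f ∩ interior (edom φ)).Nonempty)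
    (lam : ℝ) (hlam : 0 < lam) :
    (∀ y ∈ interior (edom φ),
      bprox φ gφ lam f y =
        {x | x ∈ interior (edom φ) ∧ ∃ u ∈ subdiff f x, gφ x + lam • u = gφ y} ∧
      bprox φ gφ lam f y =
        {x | x ∈ interior (edom φ) ∧
          ∃ u ∈ subdiff f x, (1 / lam) • gφ x + u = (1 / lam) • gφ y}) ∧
    ∃ T : EuclideanSpace ℝ (Fin n) → EuclideanSpace ℝ (Fin n),
      ContinuousOn T (interior (edom φ)) ∧
      ∀ y ∈ interior (edom φ), bprox φ gφ lam f y = {T y} := by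
  have hcP := hφ.convex.convexOn_toReal hφ.proper
  have hne : (edom f ∩ edom φ).Nonempty :=
    hdom.mono (Set.inter_subset_inter_right _ interior_subset)
  have hbprox {x y} (hy : y ∈ interior (edom φ)) :=
    mem_bprox_iff (x := x) (gφ := gφ) hφ.proper hf.1 hlam hy
  have hint {g x} (hx : x ∈ edom f ∩ edom φ)
      (hmin : IsMinOn (tilted φ f lam g) (edom f ∩ edom φ) x) : x ∈ interior (edom φ) :=
    hφ.mem_interior_of_isMinOn_tilted hf hdom hlam hx hmin
  have hres : ∀ y ∈ interior (edom φ), bprox φ gφ lam f y =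
      {x | x ∈ interior (edom φ) ∧ ∃ u ∈ subdiff f x, gφ x + lam • u = gφ y} := by
    intro y hy
    ext x
    rw [hbprox hy]
    constructor
    · rintro ⟨hx, hmin⟩
      have hxU := hint hx hmin
      refine ⟨hxU, _, smul_sub_mem_subdiff_of_isMinOn_tilted hf hlam (hφ.grad x hxU) hx.1 hxU hmin,
        ?_⟩
      rw [smul_smul, mul_one_div_cancel hlam.ne', one_smul, add_sub_cancel]
    · rintro ⟨hxU, u, hu, heq⟩
      refine ⟨⟨((mem_subdiff_iff hf.1).1 hu).1, interior_subset hxU⟩, ?_⟩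
      rw [← heq]
      exact isMinOn_tilted_of_mem_subdiff hcP hf.1 hlam (hφ.grad x hxU) (interior_subset hxU) hu
  have hscale : ∀ a b u : EuclideanSpace ℝ (Fin n),
      a + lam • u = b ↔ (1 / lam) • a + u = (1 / lam) • b := by
    intro a b u
    rw [← (smul_right_injective _ (one_div_pos.2 hlam).ne').eq_iff, smul_add, smul_smul,
      one_div_mul_cancel hlam.ne', one_smul]
  refine ⟨fun y hy => ⟨hres y hy, ?_⟩, ?_⟩
  · simpa only [hscale] using hres y hy
  · choose S hSmem hSmin using
      exists_isMinOn_tilted_of_superCoercive hφ.proper hφ.lsc hφco hf hlam hne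
    have huniq : ∀ g, ∀ x ∈ edom f ∩ edom φ,
        IsMinOn (tilted φ f lam g) (edom f ∩ edom φ) x → x = S g := fun g x hx hmin =>
      hφ.eq_of_isMinOn_tilted hf hlam ⟨hx.1, hint hx hmin⟩
        ⟨(hSmem g).1, hint (hSmem g) (hSmin g)⟩ hmin (hSmin g)
    have hScont : Continuous S := continuous_of_unique_isMinOn_tilted
      ⟨hφ.proper, hφ.lsc, hφ.convex⟩ hf hlam hSmem hSmin huniq
    have hgcont : ContinuousOn gφ (interior (edom φ)) :=
      (hcP.subset interior_subset hcP.1.interior).continuousOn_gradient isOpen_interior hφ.grad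
    refine ⟨S ∘ gφ, hScont.comp_continuousOn hgcont, fun y hy => ?_⟩
    ext x
    rw [hbprox hy, Set.mem_singleton_iff]
    constructor
    · rintro ⟨hx, hmin⟩
      exact huniq _ x hx hmin
    · rintro rfl
      exact ⟨hSmem _, hSmin _⟩

end
end

section
/- Suppose the symmetrized Bregman distance S_φ is convex on U × U, and let T₁, T₂ : U → U be ∇φ-firmly nonexpansive and α ∈ [0,1]. Then αT₁ + (1−α)T₂ is ∇φ-firmly nonexpansive on U. -/
open scoped RealInnerProductSpace Pointwise Topology Classical

noncomputable section

theorem convex_combination_firmly_nonexpansive {n : ℕ}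
    (φ : EuclideanSpace ℝ (Fin n) → EReal)
    (gφ : EuclideanSpace ℝ (Fin n) → EuclideanSpace ℝ (Fin n))
    (hφ : IsLegendre φ gφ) (hφco : SuperCoercive φ)
    (hS : ConvexOn ℝ ((interior (edom φ)) ×ˢ (interior (edom φ)))
      (fun p : EuclideanSpace ℝ (Fin n) × EuclideanSpace ℝ (Fin n) => ⟪gφ p.1 - gφ p.2, p.1 - p.2⟫))
    (T₁ T₂ : EuclideanSpace ℝ (Fin n) → EuclideanSpace ℝ (Fin n))
    (hT₁U : ∀ x ∈ interior (edom φ), T₁ x ∈ interior (edom φ))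
    (hT₂U : ∀ x ∈ interior (edom φ), T₂ x ∈ interior (edom φ))
    (hT₁ : ∀ u ∈ interior (edom φ), ∀ v ∈ interior (edom φ),
      ⟪gφ (T₁ u) - gφ (T₁ v), T₁ u - T₁ v⟫ ≤ ⟪u - v, T₁ u - T₁ v⟫)
    (hT₂ : ∀ u ∈ interior (edom φ), ∀ v ∈ interior (edom φ),
      ⟪gφ (T₂ u) - gφ (T₂ v), T₂ u - T₂ v⟫ ≤ ⟪u - v, T₂ u - T₂ v⟫)
    (α : ℝ) (hα0 : 0 ≤ α) (hα1 : α ≤ 1) :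
    ∀ u ∈ interior (edom φ), ∀ v ∈ interior (edom φ),
      ⟪gφ (α • T₁ u + (1 - α) • T₂ u) - gφ (α • T₁ v + (1 - α) • T₂ v),
          (α • T₁ u + (1 - α) • T₂ u) - (α • T₁ v + (1 - α) • T₂ v)⟫ ≤
        ⟪u - v, (α • T₁ u + (1 - α) • T₂ u) - (α • T₁ v + (1 - α) • T₂ v)⟫ := by
  intro u hu v hv
  have hconv := hS.2 (Set.mk_mem_prod (hT₁U u hu) (hT₁U v hv))
    (Set.mk_mem_prod (hT₂U u hu) (hT₂U v hv)) hα0 (sub_nonneg.2 hα1) (by ring)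
  simp only [Prod.fst_add, Prod.snd_add, Prod.smul_fst, Prod.smul_snd, smul_eq_mul] at hconv
  have hsplit : (α • T₁ u + (1 - α) • T₂ u) - (α • T₁ v + (1 - α) • T₂ v) =
      α • (T₁ u - T₁ v) + (1 - α) • (T₂ u - T₂ v) := by module
  refine hconv.trans ?_
  rw [hsplit, inner_add_right, real_inner_smul_right, real_inner_smul_right]
  exact add_le_add (mul_le_mul_of_nonneg_left (hT₁ u hu v hv) hα0)
    (mul_le_mul_of_nonneg_left (hT₂ u hu v hv) (sub_nonneg.2 hα1))

end
end
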